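/- Let X ⊆ ℝⁿ be a compact set, f : ℝⁿ → ℝ be upper semicontinuous on X, and let f̂ denote the concave envelope of f over conv(X). Then f̂ is upper semicontinuous on conv(X). -/

import Mathlib

open Finset

/-- The concave envelope of `f` over `conv(X)`. -/
noncomputable def concaveEnvelope {n : ℕ} (X : Set (Fin n → ℝ)) (f : (Fin n → ℝ) → ℝ)
    (x : Fin n → ℝ) : ℝ :=
  sSup { s : ℝ | ∃ (lam : Fin (n + 1) → ℝ) (xs : Fin (n + 1) → Fin n → ℝ),
    (∀ k, 0 ≤ lam k) ∧ (∑ k, lam k = 1) ∧ (∀ k, xs k ∈ X) ∧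
    (∑ k, lam k • xs k = x) ∧ s = ∑ k, lam k * f (xs k) }

open Filter Topology in
theorem UpperSemicontinuousWithinAt.continuousWithinAt_mul {α : Type*} [TopologicalSpace α]
    {s : Set α} {a : α} {g h : α → ℝ} (hh : UpperSemicontinuousWithinAt h s a)
    (hg : ContinuousWithinAt g s a) (hg0 : ∀ x ∈ s, 0 ≤ g x) :
    UpperSemicontinuousWithinAt (fun x => g x * h x) s a := by
  intro c hc
  have hcont : Tendsto (fun y => g a * y) (𝓝[>] (h a)) (𝓝 (g a * h a)) :=
    ((continuous_const.mul continuous_id).tendsto _).mono_left nhdsWithin_le_nhds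
  obtain ⟨y, hyc, hy⟩ := ((hcont.eventually_lt_const hc).and self_mem_nhdsWithin).exists
  have hgy : ∀ᶠ x in 𝓝[s] a, g x * y < c :=
    (Tendsto.mul_const y hg).eventually_lt_const hyc
  filter_upwards [hgy, hh y hy, self_mem_nhdsWithin] with x h1 h2 hx
  exact (mul_le_mul_of_nonneg_left h2.le (hg0 x hx)).trans_lt h1

/-- Carathéodory's theorem with exactly `n + 1` (possibly repeated) points. -/
theorem exists_fin_convex_combination_of_mem_convexHull {n : ℕ} {X : Set (Fin n → ℝ)}
    {x : Fin n → ℝ} (hx : x ∈ convexHull ℝ X) :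
    ∃ (lam : Fin (n + 1) → ℝ) (xs : Fin (n + 1) → Fin n → ℝ),
      (∀ k, 0 ≤ lam k) ∧ (∑ k, lam k = 1) ∧ (∀ k, xs k ∈ X) ∧ ∑ k, lam k • xs k = x := by
  obtain ⟨x₀, hx₀⟩ := convexHull_nonempty_iff.1 ⟨x, hx⟩
  obtain ⟨ι, _, z, w, hz, hind, hw, hw1, hwz⟩ := eq_pos_convex_span_of_mem_convexHull hx
  have hcard : Fintype.card ι ≤ Fintype.card (Fin (n + 1)) := by
    refine hind.card_le_finrank_succ.trans ?_
    simpa using Submodule.finrank_le (vectorSpan ℝ (Set.range z))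
  obtain ⟨e⟩ := Function.Embedding.nonempty_of_card_le hcard
  refine ⟨Function.extend e w 0, Function.extend e z fun _ => x₀, fun k => ?_, ?_, fun k => ?_, ?_⟩
  · by_cases hk : ∃ i, e i = k
    · obtain ⟨i, rfl⟩ := hk
      simpa [e.injective.extend_apply] using (hw i).le
    · simp [Function.extend_apply' _ _ _ hk]
  · rw [← hw1]
    refine (Fintype.sum_of_injective e e.injective _ _ (fun k hk => ?_) fun i => ?_).symm
    · exact Function.extend_apply' _ _ _ hk
    · exact (e.injective.extend_apply _ _ _).symm
  · by_cases hk : ∃ i, e i = k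
    · obtain ⟨i, rfl⟩ := hk
      rw [e.injective.extend_apply]
      exact hz ⟨i, rfl⟩
    · rwa [Function.extend_apply' _ _ _ hk]
  · rw [← hwz]
    refine (Fintype.sum_of_injective e e.injective _ _ (fun k hk => ?_) fun i => ?_).symm
    · rw [Function.extend_apply' w _ _ hk, Pi.zero_apply, zero_smul]
    · rw [e.injective.extend_apply, e.injective.extend_apply]

theorem upperSemicontinuousOn_sum_mul_comp {ι E : Type*} [Fintype ι] [TopologicalSpace E]
    {X : Set E} {f : E → ℝ} (hf : UpperSemicontinuousOn f X) :
    UpperSemicontinuousOn (fun p : (ι → ℝ) × (ι → E) => ∑ k, p.1 k * f (p.2 k))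
      (stdSimplex ℝ ι ×ˢ Set.univ.pi fun _ => X) := by
  refine upperSemicontinuousOn_sum fun k _ p hp => ?_
  refine UpperSemicontinuousWithinAt.continuousWithinAt_mul ?_ ?_ fun q hq => hq.1.1 k
  · intro c hc
    have hcont : Continuous fun q : (ι → ℝ) × (ι → E) => q.2 k := by fun_prop
    exact (hcont.continuousWithinAt.tendsto_nhdsWithin fun q hq => hq.2 k trivial).eventually
      (hf _ (hp.2 k trivial) c hc)
  · exact Continuous.continuousWithinAt (by fun_prop)

theorem upperSemicontinuousOn_concaveEnvelope
    {n : ℕ} (X : Set (Fin n → ℝ)) (hX : IsCompact X)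
    (f : (Fin n → ℝ) → ℝ) (hf : UpperSemicontinuousOn f X) :
    UpperSemicontinuousOn (concaveEnvelope X f) (convexHull ℝ X) := by
  intro x₀ _ c hc
  obtain ⟨c', hc', hcc⟩ := exists_between hc
  have hF := upperSemicontinuousOn_sum_mul_comp (ι := Fin (n + 1)) hf
  have hK : IsCompact (stdSimplex ℝ (Fin (n + 1)) ×ˢ
      Set.univ.pi fun _ : Fin (n + 1) => X) :=
    (isCompact_stdSimplex ℝ _).prod (isCompact_univ_pi fun _ => hX)
  have hm : Continuous fun p : (Fin (n + 1) → ℝ) × (Fin (n + 1) → Fin n → ℝ) =>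
      ∑ k, p.1 k • p.2 k := by fun_prop
  have hS := ((hF.isCompact_inter_preimage_Ici hK c').image hm).isClosed
  have hx₀ := hS.isOpen_compl.mem_nhds (x := x₀) <| by
    rintro ⟨p, ⟨hp, hpc⟩, hpx⟩
    refine (hc'.trans_le hpc).not_ge (le_csSup ?_ ?_)
    · refine (hF.bddAbove_of_isCompact hK).mono ?_
      rintro _ ⟨lam, xs, h0, h1, hxs, -, rfl⟩
      exact ⟨(lam, xs), ⟨⟨h0, h1⟩, fun k _ => hxs k⟩, rfl⟩
    · exact ⟨p.1, p.2, hp.1.1, hp.1.2, fun k => hp.2 k trivial, hpx, rfl⟩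
  filter_upwards [mem_nhdsWithin_of_mem_nhds hx₀, self_mem_nhdsWithin] with x hxS hx
  refine lt_of_le_of_lt (csSup_le ?_ ?_) hcc
  · obtain ⟨lam, xs, h0, h1, hxs, hsum⟩ := exists_fin_convex_combination_of_mem_convexHull hx
    exact ⟨_, lam, xs, h0, h1, hxs, hsum, rfl⟩
  · rintro _ ⟨lam, xs, h0, h1, hxs, hsum, rfl⟩
    by_contra! hlt
    exact hxS ⟨(lam, xs), ⟨⟨⟨h0, h1⟩, fun k _ => hxs k⟩, hlt.le⟩, hsum⟩
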